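/- arXiv:2209.14453 — 2 statements merged into one kernel-verified Lean document; each statement's English description precedes it below -/
import Mathlib

section
/- (Characterization of normal parameters) Let F = {(λ_i, k_i, d_i)}_{i=1}^N with λ_i, d_i real and k_i positive integers, and let (γ_j)_{j=1}^{S'} be the non-ascending sequence in which λ_i occurs k_i times. Then F is the family of normal parameters of a Gaussian state on S modes iff: (0) λ_i > 0 and d_i ≥ 0 for all i; (1) S' is even, S' = 2S; and (2) γ_j γ_{2S-j+1} ≥ 1 for all j = 1,…,S. -/
open Matrix MeasureTheory Real BigOperators

/-- The standard symplectic form on `2*S` coordinates: block diagonal with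
blocks `[[0,1],[-1,0]]`. -/
noncomputable def Jmat (S : ℕ) : Matrix (Fin (2*S)) (Fin (2*S)) ℝ :=
  Matrix.of fun i j =>
    if i.val % 2 = 0 ∧ j.val = i.val + 1 then 1
    else if j.val % 2 = 0 ∧ i.val = j.val + 1 then -1 else 0

/-- A real `2S × 2S` matrix is symplectic if `Aᵀ J A = J`. -/
def IsSymplectic {S : ℕ} (A : Matrix (Fin (2*S)) (Fin (2*S)) ℝ) : Prop :=
  Aᵀ * Jmat S * A = Jmat S

/-- The thermal diagonal matrix `diag (ν₁, ν₁, …, ν_S, ν_S)`. -/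
noncomputable def thermal {S : ℕ} (ν : Fin S → ℝ) :
    Matrix (Fin (2*S)) (Fin (2*S)) ℝ :=
  Matrix.diagonal fun i => ν ⟨i.val / 2, by omega⟩

/-- The other coordinate of the mode to which the coordinate `i` belongs. -/
def modePartner {S : ℕ} (i : Fin (2*S)) : Fin (2*S) :=
  if h : i.val % 2 = 0 then ⟨i.val + 1, by omega⟩ else ⟨i.val - 1, by omega⟩

lemma modePartner_modePartner {S : ℕ} (i : Fin (2*S)) : modePartner (modePartner i) = i := by
  apply Fin.ext
  unfold modePartner
  split_ifs with h1 h2 h2 <;> simp only at h2 ⊢ <;> omega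

lemma Jmat_apply {S : ℕ} (i j : Fin (2*S)) :
    Jmat S i j = if j = modePartner i then (if i.val % 2 = 0 then 1 else -1) else 0 := by
  simp only [Jmat, Matrix.of_apply, modePartner, Fin.ext_iff]
  split_ifs <;> first | rfl | (simp only at *; omega)

lemma Jmat_mulVec {S : ℕ} (v : Fin (2*S) → ℝ) (i : Fin (2*S)) :
    (Jmat S *ᵥ v) i = (if i.val % 2 = 0 then 1 else -1) * v (modePartner i) := by
  simp [Matrix.mulVec, dotProduct, Jmat_apply]

lemma Jmat_mulVec_mulVec {S : ℕ} (v : Fin (2*S) → ℝ) : Jmat S *ᵥ (Jmat S *ᵥ v) = -v := by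
  ext i
  rw [Jmat_mulVec, Jmat_mulVec, modePartner_modePartner]
  simp only [modePartner, Pi.neg_apply]
  split_ifs with h1 h2 h2 <;> simp only at h2 <;> first | omega | simp

lemma sum_sq_Jmat_mulVec {S : ℕ} (v : Fin (2*S) → ℝ) :
    ∑ i, (Jmat S *ᵥ v) i ^ 2 = ∑ i, v i ^ 2 := by
  have h : ∀ i, (Jmat S *ᵥ v) i ^ 2 = v (modePartner i) ^ 2 := by
    intro i
    rw [Jmat_mulVec]
    split_ifs <;> ring
  simp_rw [h]
  exact Equiv.sum_comp (Function.Involutive.toPerm modePartner modePartner_modePartner)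
    (fun i => v i ^ 2)

lemma dotProduct_conj_diagonal_mulVec {n : Type*} [Fintype n] [DecidableEq n]
    (B : Matrix n n ℝ) (D x : n → ℝ) :
    x ⬝ᵥ ((Bᵀ * Matrix.diagonal D * B) *ᵥ x) = ∑ j, D j * (B *ᵥ x) j ^ 2 := by
  rw [← Matrix.mulVec_mulVec, ← Matrix.mulVec_mulVec, Matrix.dotProduct_mulVec,
    Matrix.vecMul_transpose, dotProduct]
  refine Finset.sum_congr rfl fun j _ => ?_
  rw [Matrix.mulVec_diagonal]
  ring

lemma sum_sq_mulVec_of_orthogonal {n : Type*} [Fintype n] [DecidableEq n]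
    {O : Matrix n n ℝ} (hO : Oᵀ * O = 1) (x : n → ℝ) :
    ∑ j, (O *ᵥ x) j ^ 2 = ∑ j, x j ^ 2 := by
  have h := dotProduct_conj_diagonal_mulVec O (fun _ => 1) x
  rw [Matrix.diagonal_one, Matrix.mul_one, hO, Matrix.one_mulVec, dotProduct] at h
  simpa [sq] using h.symm

/-- The uncertainty relation for a symplectic matrix. -/
lemma IsSymplectic.sq_sum_sq_le {S : ℕ} {A : Matrix (Fin (2*S)) (Fin (2*S)) ℝ}
    (hA : IsSymplectic A) (w : Fin (2*S) → ℝ) :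
    (∑ i, w i ^ 2) ^ 2 ≤
      (∑ i, (A *ᵥ w) i ^ 2) * ∑ i, (A *ᵥ (Jmat S *ᵥ w)) i ^ 2 := by
  have h1 : ∑ i, (A *ᵥ w) i * (Jmat S *ᵥ (A *ᵥ (Jmat S *ᵥ w))) i = -∑ i, w i ^ 2 := by
    have h2 : w ⬝ᵥ ((Aᵀ * Jmat S * A) *ᵥ (Jmat S *ᵥ w)) = -∑ i, w i ^ 2 := by
      rw [hA, Jmat_mulVec_mulVec]
      simp [dotProduct, sq]
    rw [← h2, ← Matrix.mulVec_mulVec, ← Matrix.mulVec_mulVec, Matrix.dotProduct_mulVec,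
      Matrix.vecMul_transpose, dotProduct]
  have h3 := Finset.sum_mul_sq_le_sq_mul_sq Finset.univ (A *ᵥ w)
    (Jmat S *ᵥ (A *ᵥ (Jmat S *ᵥ w)))
  rwa [h1, sum_sq_Jmat_mulVec, neg_sq] at h3

lemma exists_mulVec_eq_zero_of_card {S : ℕ} (O : Matrix (Fin (2*S)) (Fin (2*S)) ℝ)
    (P Q : Finset (Fin (2*S))) (hPQ : 2 * S < P.card + Q.card) :
    ∃ w : Fin (2*S) → ℝ, w ≠ 0 ∧ (∀ j ∉ P, (O *ᵥ w) j = 0) ∧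
      ∀ j ∉ Q, (O *ᵥ (Jmat S *ᵥ w)) j = 0 := by
  let f : (Fin (2*S) → ℝ) →ₗ[ℝ] (↥Pᶜ → ℝ) × (↥Qᶜ → ℝ) :=
    ((LinearMap.funLeft ℝ ℝ Subtype.val).comp O.mulVecLin).prod
      ((LinearMap.funLeft ℝ ℝ Subtype.val).comp (O.mulVecLin.comp (Jmat S).mulVecLin))
  have hf : LinearMap.ker f ≠ ⊥ := by
    apply LinearMap.ker_ne_bot_of_finrank_lt
    have hP := Finset.card_le_univ P
    have hQ := Finset.card_le_univ Q
    simp only [Module.finrank_prod, Module.finrank_fintype_fun_eq_card, Fintype.card_coe,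
      Finset.card_compl, Fintype.card_fin] at *
    omega
  obtain ⟨w, hw, hw0⟩ := (Submodule.ne_bot_iff _).1 hf
  rw [LinearMap.mem_ker] at hw
  refine ⟨w, hw0, fun j hj => ?_, fun j hj => ?_⟩
  · exact congrFun (congrArg Prod.fst hw) ⟨j, Finset.mem_compl.2 hj⟩
  · exact congrFun (congrArg Prod.snd hw) ⟨j, Finset.mem_compl.2 hj⟩

lemma one_le_mul_of_eigenvalue_le {S : ℕ} {A O : Matrix (Fin (2*S)) (Fin (2*S)) ℝ}
    {ν : Fin S → ℝ} {μ : Fin (2*S) → ℝ} (hA : IsSymplectic A) (hν : ∀ i, 1 ≤ ν i)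
    (hO : Oᵀ * O = 1) (hΓ : Aᵀ * thermal ν * A = Oᵀ * Matrix.diagonal μ * O)
    {P Q : Finset (Fin (2*S))} (hPQ : 2 * S < P.card + Q.card) {a b : ℝ}
    (ha : ∀ j ∈ P, μ j ≤ a) (hb : ∀ j ∈ Q, μ j ≤ b) : 1 ≤ a * b := by
  obtain ⟨w, hw0, hP, hQ⟩ := exists_mulVec_eq_zero_of_card O P Q hPQ
  have bound : ∀ (R : Finset (Fin (2*S))) (c : ℝ) (x : Fin (2*S) → ℝ),
      (∀ j ∈ R, μ j ≤ c) → (∀ j ∉ R, (O *ᵥ x) j = 0) →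
      ∑ i, (A *ᵥ x) i ^ 2 ≤ c * ∑ i, x i ^ 2 := by
    intro R c x hR hx
    calc ∑ i, (A *ᵥ x) i ^ 2
        ≤ ∑ i : Fin (2*S), ν ⟨i.val / 2, by omega⟩ * (A *ᵥ x) i ^ 2 :=
          Finset.sum_le_sum fun i _ => le_mul_of_one_le_left (sq_nonneg _) (hν _)
      _ = ∑ j, μ j * (O *ᵥ x) j ^ 2 := by
          rw [← dotProduct_conj_diagonal_mulVec O, ← hΓ, thermal,
            dotProduct_conj_diagonal_mulVec]
      _ ≤ ∑ j, c * (O *ᵥ x) j ^ 2 := by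
          refine Finset.sum_le_sum fun j _ => ?_
          by_cases hj : j ∈ R
          · exact mul_le_mul_of_nonneg_right (hR j hj) (sq_nonneg _)
          · simp [hx j hj]
      _ = c * ∑ i, x i ^ 2 := by
          rw [← Finset.mul_sum, sum_sq_mulVec_of_orthogonal hO]
  have h1 := bound P a w ha hP
  have h2 := bound Q b _ hb hQ
  rw [sum_sq_Jmat_mulVec] at h2
  have hw : 0 < ∑ i, w i ^ 2 := by
    obtain ⟨i, hi⟩ := Function.ne_iff.1 hw0
    exact Finset.sum_pos' (fun _ _ => sq_nonneg _) ⟨i, Finset.mem_univ _, sq_pos_of_ne_zero hi⟩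
  have h3 := hA.sq_sum_sq_le w
  have h4 := mul_le_mul h1 h2 (Finset.sum_nonneg fun _ _ => sq_nonneg _)
    ((Finset.sum_nonneg fun _ _ => sq_nonneg _).trans h1)
  refine le_of_mul_le_mul_right ?_ (pow_pos hw 2)
  linarith

lemma eigenvalue_pos {S : ℕ} {A O : Matrix (Fin (2*S)) (Fin (2*S)) ℝ}
    {ν : Fin S → ℝ} {μ : Fin (2*S) → ℝ} (hA : IsSymplectic A) (hν : ∀ i, 1 ≤ ν i)
    (hO : Oᵀ * O = 1) (hΓ : Aᵀ * thermal ν * A = Oᵀ * Matrix.diagonal μ * O)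
    (j : Fin (2*S)) : 0 < μ j := by
  have h : 1 ≤ μ j * ∑ i, |μ i| := by
    refine one_le_mul_of_eigenvalue_le (P := {j}) (Q := Finset.univ) hA hν hO hΓ
      (by simp) (by simp) fun i hi => (le_abs_self _).trans ?_
    exact Finset.single_le_sum (f := fun i => |μ i|) (fun i _ => abs_nonneg _) hi
  exact pos_of_mul_pos_left (zero_lt_one.trans_le h) (Finset.sum_nonneg fun i _ => abs_nonneg _)

lemma exists_index_of_ncard {n N : ℕ} {lam : Fin N → ℝ} {k : Fin N → ℕ}
    (hn : ∑ i, k i = n) (hinj : Function.Injective lam) {γ : Fin n → ℝ}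
    (hmult : ∀ i, Set.ncard {j | γ j = lam i} = k i) :
    ∃ g : Fin n → Fin N, (∀ j, lam (g j) = γ j) ∧ ∀ i, Set.ncard {j | g j = i} = k i := by
  classical
  have hcard : (Finset.univ.biUnion fun i => Finset.univ.filter fun j => γ j = lam i).card
      = Fintype.card (Fin n) := by
    rw [Finset.card_biUnion, Fintype.card_fin]
    · refine Eq.trans ?_ hn
      refine Finset.sum_congr rfl fun i _ => ?_
      rw [← hmult i, ← Set.ncard_coe_finset]
      simp
    · intro i _ i' _ hii'
      refine Finset.disjoint_left.2 fun j hj hj' => hii' (hinj ?_)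
      simp only [Finset.mem_filter, Finset.mem_univ, true_and] at hj hj'
      rw [← hj, hj']
  have hex : ∀ j, ∃ i, lam i = γ j := by
    intro j
    have hj := Finset.mem_univ j
    rw [← (Finset.card_eq_iff_eq_univ _).1 hcard] at hj
    simp only [Finset.mem_biUnion, Finset.mem_filter, Finset.mem_univ, true_and] at hj
    exact hj.imp fun i hi => hi.symm
  choose g hg using hex
  refine ⟨g, hg, fun i => ?_⟩
  rw [← hmult i]
  congr 1
  ext j
  simp only [Set.mem_ofPred_eq, ← hg j, hinj.eq_iff]

lemma exists_equiv_of_ncard_fiber_eq {α β ι : Type*} [Finite α] [Finite β] {f : α → ι} {g : β → ι}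
    (h : ∀ i, Set.ncard {a | f a = i} = Set.ncard {b | g b = i}) :
    ∃ σ : α ≃ β, ∀ a, g (σ a) = f a := by
  have hfib : ∀ i, Nonempty ({a // f a = i} ≃ {b // g b = i}) := fun i =>
    (Finite.card_eq).1 (h i)
  exact ⟨Equiv.ofFiberEquiv fun i => (hfib i).some, fun a => Equiv.ofFiberEquiv_map _ a⟩

/-- The pairing of the sorted eigenvalue indices into modes: the mode `i` gets `i` and its
reverse. -/
def modeIndex (S : ℕ) (j : Fin (2*S)) : Fin (2*S) :=
  if j.val % 2 = 0 then ⟨j.val / 2, by omega⟩ else Fin.rev ⟨j.val / 2, by omega⟩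

lemma modeIndex_bijective (S : ℕ) : Function.Bijective (modeIndex S) := by
  refine Finite.injective_iff_bijective.1 fun i j h => ?_
  have h' := congrArg Fin.val h
  unfold modeIndex at h'
  apply Fin.ext
  split_ifs at h' <;> simp only [Fin.val_rev] at h' <;> omega

lemma isSymplectic_diagonal {S : ℕ} {a : Fin (2*S) → ℝ}
    (ha : ∀ i, a i * a (modePartner i) = 1) : IsSymplectic (Matrix.diagonal a) := by
  ext i j
  rw [Matrix.diagonal_transpose, Matrix.mul_diagonal, Matrix.diagonal_mul, Jmat_apply]
  split_ifs with h1
  · rw [h1, mul_right_comm, ha, one_mul]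
  · rw [h1, mul_right_comm, ha, one_mul]
  · simp

lemma exists_symplectic_conj_thermal_eq_diagonal {S : ℕ} {γ : Fin (2*S) → ℝ}
    (hpos : ∀ j, 0 < γ j) (hγ : ∀ j : Fin (2*S), (j : ℕ) < S → 1 ≤ γ j * γ j.rev) :
    ∃ (A : Matrix (Fin (2*S)) (Fin (2*S)) ℝ) (ν : Fin S → ℝ), IsSymplectic A ∧
      (∀ i, 1 ≤ ν i) ∧
      Aᵀ * thermal ν * A = Matrix.diagonal fun j => γ (modeIndex S j) := by
  let μ : Fin (2*S) → ℝ := fun j => γ (modeIndex S j)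
  have hμ : ∀ j, 0 < μ j := fun j => hpos _
  let a : Fin (2*S) → ℝ := fun j => √(√(μ j) / √(μ (modePartner j)))
  let ν : Fin S → ℝ := fun i => √(γ ⟨i, by omega⟩ * γ (Fin.rev ⟨i, by omega⟩))
  have hν : ∀ j : Fin (2*S), ν ⟨j.val / 2, by omega⟩ = √(μ j) * √(μ (modePartner j)) := by
    intro j
    rw [← Real.sqrt_mul (hμ j).le]
    simp only [ν, μ, modeIndex, modePartner]
    congr 1
    split_ifs with h1 h2 h2 <;> simp only at h2 <;> try omega
    · congr 4
      simp only
      omega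
    · rw [mul_comm]
      congr 3
      simp only
      omega
  refine ⟨Matrix.diagonal a, ν, isSymplectic_diagonal fun i => ?_, fun i => ?_, ?_⟩
  · have h1 := Real.sqrt_pos.2 (hμ i)
    have h2 := Real.sqrt_pos.2 (hμ (modePartner i))
    simp only [a, modePartner_modePartner]
    rw [← Real.sqrt_mul (div_pos h1 h2).le, Real.sqrt_eq_one]
    field_simp
  · exact Real.one_le_sqrt.2 (hγ _ i.isLt)
  · rw [Matrix.diagonal_transpose, thermal, Matrix.diagonal_mul_diagonal,
      Matrix.diagonal_mul_diagonal]
    congr 1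
    ext j
    have h1 := Real.sqrt_pos.2 (hμ j)
    have h2 := Real.sqrt_pos.2 (hμ (modePartner j))
    rw [hν, mul_right_comm, Real.mul_self_sqrt (div_pos h1 h2).le]
    field_simp
    exact Real.sq_sqrt (hμ j).le

lemma exists_sqrt_fiber_sum_sq_eq {m N : ℕ} {e : Fin m → Fin N} {k : Fin N → ℕ} {d : Fin N → ℝ}
    (hk : ∀ i, 0 < k i) (he : ∀ i, Set.ncard {j | e j = i} = k i) (hd : ∀ i, 0 ≤ d i) :
    ∃ v : Fin m → ℝ, ∀ i, d i =
      √(∑ j ∈ Finset.univ.filter (fun j => e j = i), v j ^ 2) := by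
  refine ⟨fun j => d (e j) / √(k (e j)), fun i => ?_⟩
  have hsum : ∑ j ∈ Finset.univ.filter (fun j => e j = i), (d (e j) / √(k (e j))) ^ 2
      = ∑ j ∈ Finset.univ.filter (fun j => e j = i), (d i ^ 2 / k i) := by
    refine Finset.sum_congr rfl fun j hj => ?_
    rw [(Finset.mem_filter.1 hj).2, div_pow, Real.sq_sqrt (Nat.cast_nonneg _)]
  have hcard : (Finset.univ.filter (fun j => e j = i)).card = k i := by
    rw [← he i, ← Set.ncard_coe_finset]
    simp
  have hki : (k i : ℝ) ≠ 0 := Nat.cast_ne_zero.2 (hk i).ne'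
  rw [hsum, Finset.sum_const, hcard, nsmul_eq_mul, mul_div_cancel₀ _ hki, Real.sqrt_sq (hd i)]

/-- `normal_params_characterization` with `∑ i, k i` replaced by a variable. -/
lemma normal_params_iff {S N n : ℕ}
    {lam d : Fin N → ℝ} {k : Fin N → ℕ} (hn : ∑ i, k i = n)
    (hk : ∀ i, 0 < k i) (hinj : Function.Injective lam)
    {γ : Fin n → ℝ} (hγ : Antitone γ)
    (hmult : ∀ i, Set.ncard {j | γ j = lam i} = k i) :
    (∃ (A O : Matrix (Fin (2*S)) (Fin (2*S)) ℝ) (ν : Fin S → ℝ)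
        (dv : Fin (2*S) → ℝ) (e : Fin (2*S) → Fin N),
      IsSymplectic A ∧ (∀ i, 1 ≤ ν i) ∧ Oᵀ * O = 1 ∧
      Aᵀ * thermal ν * A = Oᵀ * Matrix.diagonal (fun j => lam (e j)) * O ∧
      (∀ i, Set.ncard {j | e j = i} = k i) ∧
      (∀ i, d i = Real.sqrt (∑ j ∈ Finset.univ.filter (fun j => e j = i),
        (O.mulVec dv j)^2)))
    ↔ ((∀ i, 0 < lam i ∧ 0 ≤ d i) ∧ (Even n ∧ n = 2*S) ∧
        (∀ j : Fin n, (j : ℕ) < S → 1 ≤ γ j * γ j.rev)) := by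
  obtain ⟨g, hg, hgk⟩ := exists_index_of_ncard hn hinj hmult
  constructor
  · rintro ⟨A, O, ν, dv, e, hA, hν, hO, hΓ, he, hd⟩
    obtain ⟨σ, hσ⟩ := exists_equiv_of_ncard_fiber_eq (f := g) (g := e)
      fun i => (hgk i).trans (he i).symm
    have hnS : n = 2 * S := by simpa using Fintype.card_congr σ
    refine ⟨fun i => ⟨?_, ?_⟩, ⟨⟨S, by omega⟩, hnS⟩, fun j _ => ?_⟩
    · have hne : {j | e j = i}.Nonempty :=
        Set.nonempty_of_ncard_ne_zero (by rw [he i]; exact (hk i).ne')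
      obtain ⟨j, rfl⟩ := hne
      exact eigenvalue_pos hA hν hO hΓ j
    · rw [hd i]
      exact Real.sqrt_nonneg _
    · have hle : ∀ m, ∀ i ∈ (Finset.Ici m).map σ.toEmbedding, lam (e i) ≤ γ m := by
        intro m i hi
        obtain ⟨l, hl, rfl⟩ := Finset.mem_map.1 hi
        rw [Equiv.coe_toEmbedding, hσ, hg]
        exact hγ (Finset.mem_Ici.1 hl)
      refine one_le_mul_of_eigenvalue_le hA hν hO hΓ ?_ (hle j) (hle j.rev)
      simp only [Finset.card_map, Fin.card_Ici, Fin.val_rev]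
      omega
  · rintro ⟨hpos, ⟨-, rfl⟩, hprod⟩
    have hγpos : ∀ j, 0 < γ j := fun j => by
      rw [← hg j]
      exact (hpos _).1
    obtain ⟨A, ν, hA, hν, hΓ⟩ := exists_symplectic_conj_thermal_eq_diagonal hγpos hprod
    have he : ∀ i, Set.ncard {j | g (modeIndex S j) = i} = k i := fun i => by
      rw [← hgk i]
      exact Set.ncard_preimage_of_injective_subset_range (s := {j | g j = i})
        (modeIndex_bijective S).injective (by simp [(modeIndex_bijective S).surjective.range_eq])
    obtain ⟨v, hv⟩ := exists_sqrt_fiber_sum_sq_eq hk he fun i => (hpos i).2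
    refine ⟨A, 1, ν, v, fun j => g (modeIndex S j), hA, hν, by simp, ?_, he, ?_⟩
    · simpa [hg] using hΓ
    · simpa using hv

/-- characterization of normal parameters: a family
`F = {(λ_i, k_i, d_i)}_{i=1}^N` (with the `λ_i` distinct and `k_i` positive)
is the family of normal parameters of a Gaussian state on `S` modes — i.e.
there exist a symplectic `A`, symplectic eigenvalues `ν ≥ 1`, a displacement
`dv`, and an orthogonal diagonalization of `Γ = Aᵀ (thermal ν) A` whose
distinct eigenvalues are the `λ_i` with multiplicities `k_i` and whose
eigenspace projections of `dv` have norms `d_i` — iff: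
(0) all `λ_i > 0` and `d_i ≥ 0`; (1) `S' := ∑ k_i` is even with `S' = 2S`;
and (2) the non-ascending sequence `γ` in which `λ_i` occurs `k_i` times
satisfies `γ_j γ_{2S-j+1} ≥ 1` for `j ≤ S`. -/
theorem normal_params_characterization (S N : ℕ)
    (lam d : Fin N → ℝ) (k : Fin N → ℕ)
    (hk : ∀ i, 0 < k i) (hinj : Function.Injective lam)
    (γ : Fin (∑ i, k i) → ℝ) (hγ : Antitone γ)
    (hmult : ∀ i, Set.ncard {j | γ j = lam i} = k i) :
    (∃ (A O : Matrix (Fin (2*S)) (Fin (2*S)) ℝ) (ν : Fin S → ℝ)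
        (dv : Fin (2*S) → ℝ) (e : Fin (2*S) → Fin N),
      IsSymplectic A ∧ (∀ i, 1 ≤ ν i) ∧ Oᵀ * O = 1 ∧
      Aᵀ * thermal ν * A = Oᵀ * Matrix.diagonal (fun j => lam (e j)) * O ∧
      (∀ i, Set.ncard {j | e j = i} = k i) ∧
      (∀ i, d i = Real.sqrt (∑ j ∈ Finset.univ.filter (fun j => e j = i),
        (O.mulVec dv j)^2)))
    ↔ ((∀ i, 0 < lam i ∧ 0 ≤ d i) ∧
        (Even (∑ i, k i) ∧ (∑ i, k i) = 2*S) ∧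
        (∀ j : Fin (∑ i, k i), (j : ℕ) < S → 1 ≤ γ j * γ j.rev)) := by
  exact normal_params_iff rfl hk hinj hγ hmult
end

section
/- Let Γ be a pure covariance matrix (Γ = AᵀA, A symplectic) with distinct eigenvalues λ_i of multiplicities k_i, and let (γ_j)_{j=1}^{2S} be the non-ascending sequence in which λ_i occurs k_i times. Then the S squeezing parameters of the state are ln(γ_j)/2 for j = 1,…,S, i.e., if A = KQL with K,L orthogonal symplectic and Q = diag(e^{r_1}, e^{-r_1},…, e^{r_S}, e^{-r_S}) with r_j ≥ 0, then the multiset {e^{2r_j}: j ≤ S} equals {γ_j : j ≤ S}. -/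
open Matrix MeasureTheory Real BigOperators

/-- Orthogonally similar diagonal matrices have the same diagonal entries, with multiplicity. -/
theorem Matrix.map_univ_eq_of_orthogonal_conj_diagonal {n R : Type*} [Fintype n] [DecidableEq n]
    [CommRing R] [IsDomain R] {U V : Matrix n n R} (hU : Uᵀ * U = 1) (hV : Vᵀ * V = 1)
    {c d : n → R} (h : Uᵀ * diagonal c * U = Vᵀ * diagonal d * V) :
    Finset.univ.val.map c = Finset.univ.val.map d := by
  have charpoly_conj {W : Matrix n n R} (hW : Wᵀ * W = 1) (e : n → R) :
      (Wᵀ * diagonal e * W).charpoly =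
        ((Finset.univ.val.map e).map fun a => Polynomial.X - Polynomial.C a).prod := by
    rw [mul_assoc, charpoly_mul_comm, mul_assoc, mul_eq_one_comm.mp hW, mul_one,
      charpoly_diagonal, Multiset.map_map]
    rfl
  rw [← Polynomial.roots_multiset_prod_X_sub_C (Finset.univ.val.map c), ← charpoly_conj hU, h,
    charpoly_conj hV, Polynomial.roots_multiset_prod_X_sub_C]

/-- An antitone tuple is determined by its multiset of values. -/
theorem Antitone.eq_of_map_univ_eq {n : ℕ} {α : Type*} [PartialOrder α] {f g : Fin n → α}
    (hf : Antitone f) (hg : Antitone g)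
    (h : Finset.univ.val.map f = Finset.univ.val.map g) : f = g := by
  apply List.ofFn_injective
  refine List.Perm.eq_of_pairwise' hf.sortedGE_ofFn.pairwise hg.sortedGE_ofFn.pairwise ?_
  rw [← Multiset.coe_eq_coe]
  simpa [Fin.univ_val_map] using h

/-- The modes indexed so that the two quadratures of each mode are adjacent. -/
noncomputable def finSumEquivInterleave (S : ℕ) : Fin S ⊕ Fin S ≃ Fin (2 * S) :=
  Equiv.ofBijective
    (Sum.elim (fun j => ⟨2 * j, by omega⟩) (fun j => ⟨2 * j + 1, by omega⟩)) <| by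
    refine (Fintype.bijective_iff_injective_and_card _).mpr ⟨?_, by simp [two_mul]⟩
    rintro (⟨i, hi⟩ | ⟨i, hi⟩) (⟨j, hj⟩ | ⟨j, hj⟩) h <;> simp at h ⊢ <;> omega

/-- The first summand in increasing order, followed by the second one in decreasing order. -/
noncomputable def finSumEquivReflect (S : ℕ) : Fin S ⊕ Fin S ≃ Fin (2 * S) :=
  Equiv.ofBijective
    (Sum.elim (fun j => ⟨j, by omega⟩) (fun j => ⟨2 * S - 1 - j, by omega⟩)) <| by
    refine (Fintype.bijective_iff_injective_and_card _).mpr ⟨?_, by simp [two_mul]⟩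
    rintro (⟨i, hi⟩ | ⟨i, hi⟩) (⟨j, hj⟩ | ⟨j, hj⟩) h <;> simp at h ⊢ <;> omega

/-- for a pure covariance matrix `Γ = Aᵀ A` with Bloch–Messiah
decomposition `A = K Q L` (`K, L` orthogonal symplectic, `Q` diagonal with
blocks `diag(e^{r_j}, e^{-r_j})`, `r_j ≥ 0`), and `γ` the non-ascending
eigenvalue sequence of `Γ` (via an orthogonal diagonalization), the multiset
`{e^{2 r_j} : j ≤ S}` equals `{γ_j : j ≤ S}`: the squeezing parameters are
`ln(γ_j)/2` for `j = 1, …, S`. -/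
theorem pure_squeezing_from_spectrum (S : ℕ)
    (A K L : Matrix (Fin (2*S)) (Fin (2*S)) ℝ)
    (hA : IsSymplectic A) (hK : IsSymplectic K) (hL : IsSymplectic L)
    (hKO : Kᵀ * K = 1) (hLO : Lᵀ * L = 1)
    (r : Fin S → ℝ) (hr : ∀ j, 0 ≤ r j)
    (hQ : A = K * Matrix.diagonal (fun i : Fin (2*S) =>
        if i.val % 2 = 0 then Real.exp (r ⟨i.val / 2, by omega⟩)
        else Real.exp (-(r ⟨i.val / 2, by omega⟩))) * L)
    (γ : Fin (2*S) → ℝ) (hmono : Antitone γ)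
    (O : Matrix (Fin (2*S)) (Fin (2*S)) ℝ) (hO : Oᵀ * O = 1)
    (hdiag : Aᵀ * A = Oᵀ * Matrix.diagonal γ * O) :
    ∃ σ : Equiv.Perm (Fin S), ∀ j : Fin S,
      Real.exp (2 * r (σ j)) = γ (Fin.castLE (by omega) j) := by
  set q : Fin (2 * S) → ℝ := fun i => if i.val % 2 = 0 then Real.exp (r ⟨i.val / 2, by omega⟩)
    else Real.exp (-(r ⟨i.val / 2, by omega⟩)) with hq
  have h_gram : Aᵀ * A = Lᵀ * diagonal (fun i => q i * q i) * L := by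
    have : (K * diagonal q * L)ᵀ * (K * diagonal q * L) =
        Lᵀ * (diagonal q * (Kᵀ * K) * diagonal q) * L := by
      simp only [transpose_mul, diagonal_transpose, mul_assoc]
    rw [hQ, this, hKO, mul_one, diagonal_mul_diagonal]
  have h_spec := map_univ_eq_of_orthogonal_conj_diagonal hO hLO (hdiag.symm.trans h_gram)
  let σ : Equiv.Perm (Fin S) := Tuple.sort (-r)
  have hσ : Antitone (r ∘ σ) := fun i j hij => by
    simpa using Tuple.monotone_sort (-r) hij
  let ρ : Equiv.Perm (Fin (2 * S)) :=
    (finSumEquivReflect S).symm.trans ((σ.sumCongr σ).trans (finSumEquivInterleave S))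
  let g : Fin (2 * S) → ℝ := fun i => q (ρ i) * q (ρ i)
  have hg_inl (j : Fin S) : g (finSumEquivReflect S (.inl j)) = Real.exp (2 * r (σ j)) := by
    simp [g, ρ, hq, finSumEquivInterleave, ← Real.exp_add, ← two_mul]
  have hg_inr (j : Fin S) : g (finSumEquivReflect S (.inr j)) = Real.exp (-(2 * r (σ j))) := by
    have h_half : (2 * (σ j : ℕ) + 1) / 2 = σ j := by omega
    simp [g, ρ, hq, finSumEquivInterleave, ← Real.exp_add, ← two_mul, h_half]
  have hg : Antitone g := by
    intro a b hab
    obtain ⟨x, rfl⟩ := (finSumEquivReflect S).surjective a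
    obtain ⟨y, rfl⟩ := (finSumEquivReflect S).surjective b
    rcases x with i | i <;> rcases y with j | j <;>
      simp only [hg_inl, hg_inr, Real.exp_le_exp] <;>
      simp only [finSumEquivReflect, Equiv.ofBijective_apply, Sum.elim_inl, Sum.elim_inr,
        Fin.mk_le_mk] at hab
    · have := hσ (show i ≤ j from hab)
      simp only [Function.comp_apply] at this
      linarith
    · linarith [hr (σ i), hr (σ j)]
    · omega
    · have := hσ (show j ≤ i by rw [Fin.le_def]; omega)
      simp only [Function.comp_apply] at this
      linarith
  have hγ : γ = g := by
    refine hmono.eq_of_map_univ_eq hg (h_spec.trans ?_)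
    conv_lhs => rw [← Multiset.map_univ_val_equiv ρ, Multiset.map_map]
    rfl
  refine ⟨σ, fun j => ?_⟩
  rw [hγ, ← hg_inl]
  rfl
end
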